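/- Let (u₁, θ₁) and (u₂, θ₂) be two smooth solutions of the thermoelastic system with the same initial data u₀, v₀, θ₀. Assume in addition that θ₁ and θ₂ are bounded on (0,∞)×Ω, that sup_{t>0} ‖div u_{2,t}(t,·)‖_{L²(Ω)} < ∞, and that ∫₀^T ‖∇²θ₁(t,·)‖²_{L²(Ω)} dt < ∞ for every T > 0. Then u₁ = u₂ and θ₁ = θ₂ on [0,∞)×Ω. -/

import Mathlib

open MeasureTheory Real Filter Set
open scoped Topology

noncomputable section

/-- Euclidean space `ℝ^d`. -/
abbrev Ed (d : ℕ) := EuclideanSpace ℝ (Fin d)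

/-- Partial derivative of a scalar function in the `i`-th coordinate direction. -/
def pd {d : ℕ} (i : Fin d) (f : Ed d → ℝ) (x : Ed d) : ℝ :=
  fderiv ℝ f x (EuclideanSpace.single i 1)

/-- Divergence of a vector field. -/
def divg {d : ℕ} (w : Ed d → Ed d) (x : Ed d) : ℝ :=
  ∑ i, pd i (fun y => w y i) x

/-- Laplacian of a scalar function. -/
def lap {d : ℕ} (f : Ed d → ℝ) (x : Ed d) : ℝ :=
  ∑ i, pd i (fun y => pd i f y) x

/-- Squared euclidean norm of the gradient of a scalar function. -/
def gradNormSq {d : ℕ} (f : Ed d → ℝ) (x : Ed d) : ℝ :=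
  ∑ i, (pd i f x) ^ 2

/-- Squared Frobenius norm of the Hessian of a scalar function. -/
def hessNormSq {d : ℕ} (f : Ed d → ℝ) (x : Ed d) : ℝ :=
  ∑ i, ∑ j, (pd i (fun y => pd j f y) x) ^ 2

/-- The antisymmetric curl two-form `(curl w)ᵢⱼ = ∂ᵢ wⱼ - ∂ⱼ wᵢ`. -/
def curlM {d : ℕ} (w : Ed d → Ed d) (x : Ed d) (i j : Fin d) : ℝ :=
  pd i (fun y => w y j) x - pd j (fun y => w y i) x

/-- `|curl w|²`: in dimension 2 (scalar curl) and 3 (vector curl) this equals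
the squared norm of the curl. -/
def curlNormSq {d : ℕ} (w : Ed d → Ed d) (x : Ed d) : ℝ :=
  (1 / 2) * ∑ i, ∑ j, (curlM w x i j) ^ 2

/-- `j`-th component of `curl curl w` (in dimensions 2 and 3 this is
`∑ i ∂ᵢ (∂ⱼ wᵢ - ∂ᵢ wⱼ) = ∂ⱼ (div w) - Δ wⱼ`). -/
def ccurl {d : ℕ} (w : Ed d → Ed d) (x : Ed d) (j : Fin d) : ℝ :=
  ∑ i, pd i (fun y => curlM w y j i) x

/-- `j`-th component of the componentwise Laplacian of a vector field. -/
def veclap {d : ℕ} (w : Ed d → Ed d) (x : Ed d) (j : Fin d) : ℝ :=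
  ∑ i, pd i (fun y => pd i (fun z => w z j) y) x

/-- Time derivative of a time-dependent field. -/
def tder {α : Type*} {F : Type*} [NormedAddCommGroup F] [NormedSpace ℝ F]
    (u : ℝ → α → F) : ℝ → α → F :=
  fun t x => deriv (fun s => u s x) t

/-- An open, bounded, convex domain in `ℝ^d` (`d ∈ {2,3}`) together with its outward
unit normal field `n` on the boundary.  For a convex body with smooth boundary the
outward unit normal at a boundary point is characterized by the supporting
half-space inequality. -/
structure GoodDomain (d : ℕ) (Ω : Set (Ed d)) (n : Ed d → Ed d) : Prop where
  dims : d = 2 ∨ d = 3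
  isOpen : IsOpen Ω
  bounded : Bornology.IsBounded Ω
  convex : Convex ℝ Ω
  nonempty : Ω.Nonempty
  normal_unit : ∀ x ∈ frontier Ω, ‖n x‖ = 1
  normal_outward : ∀ x ∈ frontier Ω, ∀ y ∈ closure Ω, ∑ i, (y i - x i) * n x i ≤ 0

/-- A smooth solution `(u, θ)` of the thermoelastic system
`u_tt - (2μ+λ)∇(div u) + μ curl curl u = -ν∇θ`, `θ_t - Δθ = -ν θ div u_t`
with boundary conditions `u·n = 0`, `𝒩u = 0` (encoded as `(curl u) n = 0`,
which in dimension 2 means `curl u = 0` and in dimension 3 means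
`curl u × n = 0`) and `∇θ·n = 0`, and with positive temperature. -/
structure IsSolution {d : ℕ} (Ω : Set (Ed d)) (n : Ed d → Ed d)
    (μ lam ν : ℝ) (u : ℝ → Ed d → Ed d) (θ : ℝ → Ed d → ℝ) : Prop where
  smooth_u : ContDiff ℝ (⊤ : ℕ∞) (fun p : ℝ × Ed d => u p.1 p.2)
  smooth_θ : ContDiff ℝ (⊤ : ℕ∞) (fun p : ℝ × Ed d => θ p.1 p.2)
  theta_pos : ∀ t : ℝ, 0 ≤ t → ∀ x ∈ closure Ω, 0 < θ t x
  wave : ∀ t : ℝ, 0 < t → ∀ x ∈ Ω, ∀ j : Fin d,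
    tder (tder u) t x j - (2 * μ + lam) * pd j (divg (u t)) x
      + μ * ccurl (u t) x j = -ν * pd j (θ t) x
  heat : ∀ t : ℝ, 0 < t → ∀ x ∈ Ω,
    tder θ t x - lap (θ t) x = -ν * θ t x * divg (tder u t) x
  bc_u : ∀ t : ℝ, 0 < t → ∀ x ∈ frontier Ω, ∑ i, u t x i * n x i = 0
  bc_N : ∀ t : ℝ, 0 < t → ∀ x ∈ frontier Ω, ∀ i : Fin d,
    ∑ j, curlM (u t) x i j * n x j = 0
  bc_θ : ∀ t : ℝ, 0 < t → ∀ x ∈ frontier Ω, ∑ i, pd i (θ t) x * n x i = 0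

/-- The functional `F(u, u_t, θ)` built from the Fisher information and
higher-order derivatives of the displacement. -/
def Ffun {d : ℕ} (Ω : Set (Ed d)) (μ lam : ℝ)
    (u : ℝ → Ed d → Ed d) (θ : ℝ → Ed d → ℝ) (t : ℝ) : ℝ :=
  (1 / 2) * ((∫ x in Ω, (divg (tder u t) x) ^ 2)
    + (∫ x in Ω, curlNormSq (tder u t) x)
    + (2 * μ + lam) * (∫ x in Ω, gradNormSq (divg (u t)) x)
    + μ * (∫ x in Ω, ∑ j, (ccurl (u t) x j) ^ 2)
    + (∫ x in Ω, gradNormSq (θ t) x / θ t x))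

/-- The small-data condition
`‖div v₀‖² + ‖curl v₀‖² + (2μ+λ)‖∇div u₀‖² + μ‖curl curl u₀‖² + ‖∇θ₀/√θ₀‖² ≤ D`. -/
def smallData {d : ℕ} (Ω : Set (Ed d)) (μ lam : ℝ)
    (u0 v0 : Ed d → Ed d) (θ0 : Ed d → ℝ) (D : ℝ) : Prop :=
  (∫ x in Ω, (divg v0 x) ^ 2) + (∫ x in Ω, curlNormSq v0 x)
    + (2 * μ + lam) * (∫ x in Ω, gradNormSq (divg u0) x)
    + μ * (∫ x in Ω, ∑ j, (ccurl u0 x j) ^ 2)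
    + (∫ x in Ω, gradNormSq θ0 x / θ0 x) ≤ D

/-- The norm `‖w‖_H = (‖div w‖² + ‖curl w‖²)^{1/2}`. -/
def Hnorm {d : ℕ} (Ω : Set (Ed d)) (w : Ed d → Ed d) : ℝ :=
  Real.sqrt ((∫ x in Ω, (divg w x) ^ 2) + (∫ x in Ω, curlNormSq w x))

end

theorem sum_mul_eq_inner {d : ℕ} (x y : Ed d) : ∑ i, x i * y i = inner ℝ x y := by
  simp [PiLp.inner_apply, mul_comm]

/-- A point of an open set reaches its nearest point of the complement along the outward
normal there. -/
theorem exists_nearest_frontier {d : ℕ} {Ω : Set (Ed d)} {n : Ed d → Ed d} (ho : IsOpen Ω)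
    (hne : Ωᶜ.Nonempty) (hn : ∀ x ∈ frontier Ω, ‖n x‖ = 1)
    (hout : ∀ x ∈ frontier Ω, ∀ y ∈ closure Ω, inner ℝ (y - x) (n x) ≤ 0)
    {x : Ed d} (hx : x ∈ Ω) :
    ∃ z ∈ frontier Ω, 0 < Metric.infDist x Ωᶜ ∧ Metric.infDist x Ωᶜ = ‖x - z‖ ∧
      z - x = Metric.infDist x Ωᶜ • n z := by
  obtain ⟨z, hz, hxz⟩ := ho.isClosed_compl.exists_infDist_eq_dist hne x
  set ρ := Metric.infDist x Ωᶜ with hρ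
  have hpos : 0 < ρ := (ho.isClosed_compl.notMem_iff_infDist_pos hne).1 (by simpa using hx)
  have hsub : Metric.closedBall x ρ ⊆ closure Ω := by
    rw [← closure_ball x hpos.ne']
    refine closure_mono fun y hy => ?_
    by_contra hyΩ
    have := Metric.infDist_le_dist_of_mem (x := x) (s := Ωᶜ) hyΩ
    rw [Metric.mem_ball, dist_comm] at hy
    linarith
  have hzc : z ∈ closure Ω := hsub (by rw [Metric.mem_closedBall, dist_comm, hxz])
  have hzf : z ∈ frontier Ω := by
    rw [ho.frontier_eq]; exact ⟨hzc, hz⟩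
  have hz1 := hn z hzf
  have hnorm : ‖x - z‖ = ρ := by rw [hxz, dist_eq_norm]
  refine ⟨z, hzf, hpos, hnorm.symm, ?_⟩
  have h1 := hout z hzf (x + ρ • n z) (hsub (by
    simp [Metric.mem_closedBall, dist_eq_norm, norm_smul, hz1, abs_of_pos hpos]))
  have h2 : inner ℝ (x + ρ • n z - z) (n z) = inner ℝ (x - z) (n z) + ρ := by
    rw [show x + ρ • n z - z = (x - z) + ρ • n z by abel, inner_add_left, inner_smul_left,
      real_inner_self_eq_norm_sq, hz1]
    simp
  have h3 : ‖(x - z) + ρ • n z‖ ^ 2 ≤ 0 := by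
    rw [norm_add_sq_real, inner_smul_right, norm_smul, hz1, hnorm, Real.norm_eq_abs,
      abs_of_pos hpos]
    nlinarith
  have h4 : (x - z) + ρ • n z = 0 := by
    rw [← norm_eq_zero]
    exact pow_eq_zero_iff two_ne_zero |>.1 (le_antisymm h3 (sq_nonneg _))
  rw [← sub_eq_zero, ← neg_eq_zero, ← h4]
  abel

/-- The cutoff which vanishes outside `Ω` and equals one at distance at least `k⁻¹` from the
complement of `Ω`. -/
noncomputable def distCutoff {d : ℕ} (Ω : Set (Ed d)) (k : ℝ) (x : Ed d) : ℝ :=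
  min 1 (k * Metric.infDist x Ωᶜ)

theorem lipschitzWith_distCutoff {d : ℕ} (Ω : Set (Ed d)) (k : NNReal) :
    LipschitzWith k (distCutoff Ω k) := by
  refine LipschitzWith.of_dist_le_mul fun x y => ?_
  have h1 : |distCutoff Ω k x - distCutoff Ω k y| ≤
      |k * Metric.infDist x Ωᶜ - k * Metric.infDist y Ωᶜ| := by
    simpa [distCutoff] using
      abs_min_sub_min_le_max (1 : ℝ) (k * Metric.infDist x Ωᶜ) 1 (k * Metric.infDist y Ωᶜ)
  refine h1.trans ?_
  rw [← mul_sub, abs_mul, abs_of_nonneg (NNReal.coe_nonneg k)]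
  refine mul_le_mul_of_nonneg_left ?_ k.2
  simpa [Real.dist_eq] using (Metric.lipschitz_infDist_pt Ωᶜ).dist_le_mul x y

theorem distCutoff_of_notMem {d : ℕ} {Ω : Set (Ed d)} {k : ℝ} {x : Ed d} (hx : x ∉ Ω) :
    distCutoff Ω k x = 0 := by
  simp [distCutoff, Metric.infDist_zero_of_mem (show x ∈ Ωᶜ from hx)]

theorem distCutoff_nonneg {d : ℕ} {Ω : Set (Ed d)} {k : ℝ} (hk : 0 ≤ k) (x : Ed d) :
    0 ≤ distCutoff Ω k x :=
  le_min zero_le_one (mul_nonneg hk Metric.infDist_nonneg)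

theorem fderiv_distCutoff_of_notMem {d : ℕ} {Ω : Set (Ed d)} {k : ℝ} (hk : 0 ≤ k) {x : Ed d}
    (hx : x ∉ Ω) : fderiv ℝ (distCutoff Ω k) x = 0 := by
  refine IsLocalMin.fderiv_eq_zero (Filter.Eventually.of_forall fun y => ?_)
  rw [distCutoff_of_notMem hx]
  exact distCutoff_nonneg hk y

theorem fderiv_distCutoff_of_one_le {d : ℕ} {Ω : Set (Ed d)} {k : ℝ} {x : Ed d}
    (hx : 1 ≤ k * Metric.infDist x Ωᶜ) : fderiv ℝ (distCutoff Ω k) x = 0 := by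
  refine IsLocalMax.fderiv_eq_zero (Filter.Eventually.of_forall fun y => ?_)
  rw [distCutoff, distCutoff, min_eq_left hx]
  exact min_le_left _ _

/-- Lipschitz fields tangent to the boundary pair boundedly with the gradient of the cutoff,
uniformly in its thickness. -/
theorem abs_fderiv_distCutoff_apply_le {d : ℕ} {Ω : Set (Ed d)} {n : Ed d → Ed d}
    (ho : IsOpen Ω)
    (hne : Ωᶜ.Nonempty) (hn : ∀ x ∈ frontier Ω, ‖n x‖ = 1)
    (hout : ∀ x ∈ frontier Ω, ∀ y ∈ closure Ω, inner ℝ (y - x) (n x) ≤ 0)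
    {F : Ed d → Ed d} {K : NNReal} (hF : LipschitzWith K F)
    (hFn : ∀ x ∈ frontier Ω, inner ℝ (F x) (n x) = 0) {k : ℝ} (hk : 0 < k)
    {x : Ed d} (hx : x ∈ Ω) (hd : DifferentiableAt ℝ (distCutoff Ω k) x) :
    |fderiv ℝ (distCutoff Ω k) x (F x)| ≤ K := by
  by_cases h1 : 1 ≤ k * Metric.infDist x Ωᶜ
  · simp [fderiv_distCutoff_of_one_le h1]
  push Not at h1
  obtain ⟨z, hz, hpos, hρ, hzx⟩ := exists_nearest_frontier ho hne hn hout hx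
  set ρ := Metric.infDist x Ωᶜ with hρdef
  have hzΩ : z ∈ Ωᶜ := by
    rw [ho.frontier_eq] at hz; exact hz.2
  have hxz : x - z ≠ 0 := by
    rw [← norm_pos_iff, ← hρ]; exact hpos
  have hnormd : DifferentiableAt ℝ (fun y : Ed d => k * ‖y - z‖) x :=
    ((differentiableAt_id.sub_const z).norm ℝ hxz).const_mul k
  have hmin : IsLocalMin (fun y => k * ‖y - z‖ - distCutoff Ω k y) x := by
    refine Filter.Eventually.of_forall fun y => ?_
    have h2 : distCutoff Ω k x = k * ‖x - z‖ := by
      rw [distCutoff, ← hρdef, min_eq_right h1.le, hρ]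
    have h3 : distCutoff Ω k y ≤ k * ‖y - z‖ := by
      refine (min_le_right _ _).trans (mul_le_mul_of_nonneg_left ?_ hk.le)
      rw [← dist_eq_norm]
      exact Metric.infDist_le_dist_of_mem hzΩ
    simp only [h2]
    linarith
  have hzero := hmin.fderiv_eq_zero
  rw [fderiv_fun_sub hnormd hd, sub_eq_zero] at hzero
  rw [← hzero]
  have hsq : fderiv ℝ (fun y : Ed d => k * ‖y - z‖) x (F x)
      = k * (inner ℝ (x - z) (F x) / ρ) := by
    have hs : HasFDerivAt (fun y : Ed d => ‖y - z‖) (fderiv ℝ (fun y : Ed d => ‖y - z‖) x) x :=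
      ((differentiableAt_id.sub_const z).norm ℝ hxz).hasFDerivAt
    have hs2 := (hs.pow 2).unique (((hasFDerivAt_id x).sub_const z).norm_sq)
    have hs3 := congrArg (fun L => L (F x)) hs2
    simp [← hρ] at hs3
    rw [(hs.const_mul k).fderiv]
    simp only [_root_.smul_apply, smul_eq_mul]
    rw [eq_div_of_mul_eq hpos.ne' (a := fderiv ℝ (fun y : Ed d => ‖y - z‖) x (F x))]
    rw [inner_sub_left]
    linarith
  rw [hsq, show x - z = - (ρ • n z) by rw [← hzx]; abel, inner_neg_left, inner_smul_left]
  have h5 : |inner ℝ (n z) (F x)| ≤ K * ρ := by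
    have : inner ℝ (n z) (F x) = inner ℝ (n z) (F x - F z) := by
      rw [inner_sub_right, real_inner_comm (F z) (n z), hFn z hz, sub_zero]
    rw [this, hρ]
    refine (abs_real_inner_le_norm _ _).trans ?_
    rw [hn z hz, one_mul]
    exact hF.norm_sub_le x z
  simp only [conj_trivial]
  rw [neg_div, mul_div_cancel_left₀ _ hpos.ne', mul_neg, abs_neg, abs_mul, abs_of_pos hk]
  calc k * |inner ℝ (n z) (F x)| ≤ k * (K * ρ) := by gcongr
    _ = K * (k * ρ) := by ring
    _ ≤ K * 1 := by gcongr
    _ = K := mul_one _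

theorem tendsto_distCutoff {d : ℕ} {Ω : Set (Ed d)} (ho : IsOpen Ω) (hne : Ωᶜ.Nonempty)
    {x : Ed d} (hx : x ∈ Ω) :
    ∀ᶠ k : ℕ in atTop, 1 ≤ ((k + 1 : NNReal) : ℝ) * Metric.infDist x Ωᶜ := by
  have hpos : 0 < Metric.infDist x Ωᶜ :=
    (ho.isClosed_compl.notMem_iff_infDist_pos hne).1 (by simpa using hx)
  have h := (tendsto_natCast_atTop_atTop (R := ℝ)).atTop_mul_const hpos
  filter_upwards [h.eventually_ge_atTop 1] with k hk
  push_cast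
  nlinarith

theorem pd_coord_eq_lineDeriv {d : ℕ} {F : Ed d → Ed d} (hF : Differentiable ℝ F) (i : Fin d)
    (x : Ed d) :
    pd i (fun y => F y i) x = lineDeriv ℝ (fun y => F y i) x (EuclideanSpace.single i 1) := by
  have : DifferentiableAt ℝ (fun y => F y i) x := (differentiable_euclidean.1 hF i) x
  rw [this.lineDeriv_eq_fderiv, pd]

theorem setIntegral_divg_eq_zero_of_hasCompactSupport {d : ℕ} {Ω : Set (Ed d)} {n : Ed d → Ed d}
    (ho : IsOpen Ω) (hb : Bornology.IsBounded Ω)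
    (hne : Ωᶜ.Nonempty) (hn : ∀ x ∈ frontier Ω, ‖n x‖ = 1)
    (hout : ∀ x ∈ frontier Ω, ∀ y ∈ closure Ω, inner ℝ (y - x) (n x) ≤ 0)
    {F : Ed d → Ed d} (hF : ContDiff ℝ 1 F) (hFc : HasCompactSupport F)
    (hFn : ∀ x ∈ frontier Ω, inner ℝ (F x) (n x) = 0) :
    ∫ x in Ω, divg F x = 0 := by
  obtain ⟨K, hK⟩ := hF.lipschitzWith_of_hasCompactSupport hFc one_ne_zero
  have hFd : Differentiable ℝ F := hF.differentiable one_ne_zero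
  let η : ℕ → Ed d → ℝ := fun k => distCutoff Ω ((k + 1 : NNReal) : ℝ)
  have hηlip (k : ℕ) : LipschitzWith (k + 1 : NNReal) (η k) := lipschitzWith_distCutoff Ω _
  have hηc (k : ℕ) : HasCompactSupport (η k) :=
    HasCompactSupport.intro hb.isCompact_closure fun x hx =>
      distCutoff_of_notMem fun h => hx (subset_closure h)
  have hcoord (i : Fin d) : LipschitzWith K (fun x => F x i) :=
    LipschitzWith.of_dist_le_mul fun x y =>
      (by
        simpa [dist_eq_norm] using PiLp.norm_apply_le (F x - F y) i :
        dist (F x i) (F y i) ≤ dist (F x) (F y)).trans (hK.dist_le_mul x y)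
  have hcoordc (i : Fin d) : HasCompactSupport (fun x => F x i) :=
    hFc.comp_left (g := fun v : Ed d => v i) rfl
  have hcoord1 (i : Fin d) : ContDiff ℝ 1 (fun x => F x i) := contDiff_euclidean.1 hF i
  have hpdcont (i : Fin d) : Continuous (pd i fun y => F y i) :=
    ((hcoord1 i).continuous_fderiv one_ne_zero).clm_apply continuous_const
  have hpdc (i : Fin d) : HasCompactSupport (pd i fun y => F y i) :=
    ((hcoordc i).fderiv ℝ).comp_left (g := fun L : Ed d →L[ℝ] ℝ => L (EuclideanSpace.single i 1))
      rfl
  have hpdint (i : Fin d) : Integrable (pd i fun y => F y i) :=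
    (hpdcont i).integrable_of_hasCompactSupport (hpdc i)
  have hdivint : Integrable (divg F) := integrable_finsetSum _ fun i _ => hpdint i
  have hηle (k : ℕ) (x : Ed d) : ‖η k x‖ ≤ 1 := by
    rw [Real.norm_eq_abs, abs_of_nonneg (distCutoff_nonneg (NNReal.coe_nonneg _) x)]
    exact min_le_left _ _
  have hparts (k : ℕ) : ∫ x, divg F x * η k x =
      ∫ x, ∑ i, lineDeriv ℝ (η k) x (-EuclideanSpace.single i 1) * F x i := by
    have h1 : ∀ x, divg F x * η k x =
        ∑ i, lineDeriv ℝ (fun y => F y i) x (EuclideanSpace.single i 1) * η k x := fun x => by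
      rw [divg, Finset.sum_mul]
      exact Finset.sum_congr rfl fun i _ => by rw [pd_coord_eq_lineDeriv hFd]
    simp_rw [h1]
    rw [integral_finsetSum, integral_finsetSum]
    · exact Finset.sum_congr rfl fun i _ =>
        (hcoord i).integral_lineDeriv_mul_eq (hηlip k) (hηc k) _
    · intro i _
      exact ((hcoord i).continuous.integrable_of_hasCompactSupport (hcoordc i)).mul_of_top_right
        ((hηlip k).memLp_lineDeriv _)
    · intro i _
      exact ((hηlip k).continuous.integrable_of_hasCompactSupport (hηc k)).mul_of_top_right
        ((hcoord i).memLp_lineDeriv _)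
  have hleft : Tendsto (fun k => ∫ x, divg F x * η k x) atTop (𝓝 (∫ x in Ω, divg F x)) := by
    rw [← integral_indicator ho.measurableSet]
    refine tendsto_integral_of_dominated_convergence (fun x => ‖divg F x‖)
      (fun k => hdivint.1.mul (hηlip k).continuous.aestronglyMeasurable) hdivint.norm
      (fun k => .of_forall fun x => ?_) (.of_forall fun x => ?_)
    · rw [norm_mul]
      exact mul_le_of_le_one_right (norm_nonneg _) (hηle k x)
    · by_cases hx : x ∈ Ω
      · rw [indicator_of_mem hx]
        refine tendsto_const_nhds.congr' ?_
        filter_upwards [tendsto_distCutoff ho hne hx] with k hk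
        change _ = _ * min _ _
        rw [min_eq_left hk, mul_one]
      · simp [indicator_of_notMem hx, η, distCutoff_of_notMem hx]
  have hright : Tendsto
      (fun k => ∫ x, ∑ i, lineDeriv ℝ (η k) x (-EuclideanSpace.single i 1) * F x i)
      atTop (𝓝 0) := by
    have hae : ∀ᵐ x : Ed d, ∀ k, DifferentiableAt ℝ (η k) x :=
      ae_all_iff.2 fun k => (hηlip k).ae_differentiableAt
    have hη0 (k : ℕ) {x : Ed d} (hx : x ∉ Ω) : fderiv ℝ (η k) x = 0 :=
      fderiv_distCutoff_of_notMem (NNReal.coe_nonneg _) hx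
    have hsum {k : ℕ} {x : Ed d} (hd : DifferentiableAt ℝ (η k) x) :
        ∑ i, lineDeriv ℝ (η k) x (-EuclideanSpace.single i 1) * F x i =
          -fderiv ℝ (η k) x (F x) := by
      conv_rhs => rw [← (EuclideanSpace.basisFun (Fin d) ℝ).sum_repr (F x)]
      simp only [hd.lineDeriv_eq_fderiv, map_neg, map_sum, map_smul, smul_eq_mul,
        EuclideanSpace.basisFun_repr, EuclideanSpace.basisFun_apply, neg_mul,
        Finset.sum_neg_distrib]
      simp only [mul_comm]
    have hmeas (k : ℕ) : AEStronglyMeasurable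
        (fun x => ∑ i, lineDeriv ℝ (η k) x (-EuclideanSpace.single i 1) * F x i) volume := by
      refine Finset.aestronglyMeasurable_fun_sum _ fun i _ => ?_
      exact (aestronglyMeasurable_lineDeriv (hηlip k).continuous _).mul
        (hcoord i).continuous.aestronglyMeasurable
    rw [← integral_zero (Ed d) ℝ (μ := volume)]
    refine tendsto_integral_of_dominated_convergence (Ω.indicator fun _ => (K : ℝ)) hmeas
      ((integrable_indicator_iff ho.measurableSet).2
        (integrableOn_const hb.measure_lt_top.ne))
      (fun k => ?_) ?_
    · filter_upwards [hae] with x hx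
      rw [hsum (hx k), norm_neg]
      by_cases hxΩ : x ∈ Ω
      · rw [indicator_of_mem hxΩ]
        exact abs_fderiv_distCutoff_apply_le ho hne hn hout hK hFn
          (NNReal.coe_pos.2 (by positivity)) hxΩ (hx k)
      · rw [hη0 k hxΩ]
        simp [hxΩ]
    · filter_upwards [hae] with x hx
      simp_rw [fun k => hsum (hx k)]
      refine tendsto_const_nhds.congr' ?_
      by_cases hxΩ : x ∈ Ω
      · filter_upwards [tendsto_distCutoff ho hne hxΩ] with k hk
        have h0 : fderiv ℝ (η k) x = 0 := fderiv_distCutoff_of_one_le hk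
        simp [h0]
      · exact .of_forall fun k => by simp [hη0 k hxΩ]
  exact tendsto_nhds_unique hleft ((tendsto_congr hparts).2 hright)

theorem divg_congr {d : ℕ} {F G : Ed d → Ed d} {x : Ed d} (h : F =ᶠ[𝓝 x] G) :
    divg F x = divg G x := by
  refine Finset.sum_congr rfl fun i _ => ?_
  rw [pd, pd, Filter.EventuallyEq.fderiv_eq (f₁ := fun y => F y i) (f := fun y => G y i)]
  filter_upwards [h] with y hy
  rw [hy]

/-- Divergence theorem for fields tangent to the boundary of a domain admitting a supporting
half-space at every boundary point. -/
theorem setIntegral_divg_eq_zero {d : ℕ} {Ω : Set (Ed d)} {n : Ed d → Ed d}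
    (ho : IsOpen Ω) (hb : Bornology.IsBounded Ω)
    (hne : Ωᶜ.Nonempty) (hn : ∀ x ∈ frontier Ω, ‖n x‖ = 1)
    (hout : ∀ x ∈ frontier Ω, ∀ y ∈ closure Ω, inner ℝ (y - x) (n x) ≤ 0)
    {F : Ed d → Ed d} (hF : ContDiff ℝ 1 F)
    (hFn : ∀ x ∈ frontier Ω, inner ℝ (F x) (n x) = 0) :
    ∫ x in Ω, divg F x = 0 := by
  obtain ⟨R, hR, hΩR⟩ := hb.subset_ball_lt 0 0
  let χ : ContDiffBump (0 : Ed d) := ⟨R, R + 1, hR, by linarith⟩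
  have h := setIntegral_divg_eq_zero_of_hasCompactSupport ho hb hne hn hout
    (F := fun x => χ x • F x) (χ.contDiff.smul hF) χ.hasCompactSupport.smul_right
    (fun x hx => by rw [inner_smul_left, hFn x hx, mul_zero])
  rw [← h]
  refine setIntegral_congr_fun ho.measurableSet fun x hx => divg_congr ?_
  filter_upwards [ho.mem_nhds hx] with y hy
  rw [χ.one_of_mem_closedBall (Metric.ball_subset_closedBall (hΩR hy)), one_smul]

section DirectionalDerivative

variable {E : Type*} [NormedAddCommGroup E] [NormedSpace ℝ E]

/-- Derivative of a scalar function in a fixed direction. -/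
noncomputable def dirDeriv (v : E) (f : E → ℝ) (p : E) : ℝ := fderiv ℝ f p v

theorem contDiff_dirDeriv {f : E → ℝ} (hf : ContDiff ℝ (⊤ : ℕ∞) f) (v : E) :
    ContDiff ℝ (⊤ : ℕ∞) (dirDeriv v f) :=
  (hf.fderiv_right (m := (⊤ : ℕ∞)) (by simp)).clm_apply contDiff_const

theorem ContDiff.differentiable_of_top {f : E → ℝ} (hf : ContDiff ℝ (⊤ : ℕ∞) f) :
    Differentiable ℝ f :=
  hf.differentiable (by simp)

theorem dirDeriv_comm {f : E → ℝ} (hf : ContDiff ℝ (⊤ : ℕ∞) f) (v w : E) :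
    dirDeriv v (dirDeriv w f) = dirDeriv w (dirDeriv v f) := by
  funext p
  have h2 : Differentiable ℝ (fderiv ℝ f) :=
    (hf.fderiv_right (m := (⊤ : ℕ∞)) (by simp)).differentiable (by simp)
  have key (v w : E) : dirDeriv v (dirDeriv w f) p = fderiv ℝ (fderiv ℝ f) p v w := by
    have := (h2 p).hasFDerivAt.clm_apply (hasFDerivAt_const w p)
    change fderiv ℝ (fun y => fderiv ℝ f y w) p v = _
    rw [this.fderiv]
    simp
  rw [key, key]
  exact (hf.contDiffAt.isSymmSndFDerivAt (by
    rw [minSmoothness_of_isRCLikeNormedField]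
    exact WithTop.coe_le_coe.2 (le_top : (2 : ℕ∞) ≤ ⊤))) v w

variable {f g : E → ℝ}

theorem dirDeriv_add (hf : ContDiff ℝ (⊤ : ℕ∞) f) (hg : ContDiff ℝ (⊤ : ℕ∞) g) (v : E) :
    dirDeriv v (fun p => f p + g p) = fun p => dirDeriv v f p + dirDeriv v g p := by
  funext p
  simp [dirDeriv, fderiv_fun_add (hf.differentiable_of_top p) (hg.differentiable_of_top p)]

theorem dirDeriv_sub (hf : ContDiff ℝ (⊤ : ℕ∞) f) (hg : ContDiff ℝ (⊤ : ℕ∞) g) (v : E) :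
    dirDeriv v (fun p => f p - g p) = fun p => dirDeriv v f p - dirDeriv v g p := by
  funext p
  simp [dirDeriv, fderiv_fun_sub (hf.differentiable_of_top p) (hg.differentiable_of_top p)]

theorem dirDeriv_mul (hf : ContDiff ℝ (⊤ : ℕ∞) f) (hg : ContDiff ℝ (⊤ : ℕ∞) g) (v : E) :
    dirDeriv v (fun p => f p * g p) =
      fun p => f p * dirDeriv v g p + g p * dirDeriv v f p := by
  funext p
  simp [dirDeriv, fderiv_fun_mul (hf.differentiable_of_top p) (hg.differentiable_of_top p)]

theorem dirDeriv_const_mul (hf : ContDiff ℝ (⊤ : ℕ∞) f) (c : ℝ) (v : E) :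
    dirDeriv v (fun p => c * f p) = fun p => c * dirDeriv v f p := by
  funext p
  simp [dirDeriv, fderiv_const_mul (hf.differentiable_of_top p)]

theorem dirDeriv_sq (hf : ContDiff ℝ (⊤ : ℕ∞) f) (v : E) :
    dirDeriv v (fun p => f p ^ 2) = fun p => 2 * (f p * dirDeriv v f p) := by
  simp_rw [pow_two]
  rw [dirDeriv_mul hf hf]
  funext p
  ring

theorem dirDeriv_sum {ι : Type*} {s : Finset ι} {f : ι → E → ℝ}
    (hf : ∀ i, ContDiff ℝ (⊤ : ℕ∞) (f i)) (v : E) :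
    dirDeriv v (fun p => ∑ i ∈ s, f i p) = fun p => ∑ i ∈ s, dirDeriv v (f i) p := by
  funext p
  simp [dirDeriv, fderiv_fun_sum fun i _ => (hf i).differentiable_of_top p]

variable {ι : Type*}

/-- Curl of a family of functions with respect to a family of directions. -/
noncomputable def dirCurl (e : ι → E) (w : ι → E → ℝ) (i j : ι) (p : E) : ℝ :=
  dirDeriv (e i) (w j) p - dirDeriv (e j) (w i) p

variable {e : ι → E} {w w' : ι → E → ℝ}

theorem contDiff_dirCurl (hw : ∀ i, ContDiff ℝ (⊤ : ℕ∞) (w i)) (i j : ι) :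
    ContDiff ℝ (⊤ : ℕ∞) (dirCurl e w i j) :=
  (contDiff_dirDeriv (hw j) _).sub (contDiff_dirDeriv (hw i) _)

theorem dirCurl_sub (hw : ∀ i, ContDiff ℝ (⊤ : ℕ∞) (w i))
    (hw' : ∀ i, ContDiff ℝ (⊤ : ℕ∞) (w' i)) (i j : ι) :
    dirCurl e (fun i p => w i p - w' i p) i j =
      fun p => dirCurl e w i j p - dirCurl e w' i j p := by
  funext p
  simp_rw [dirCurl, dirDeriv_sub (hw _) (hw' _)]
  ring

theorem dirDeriv_dirCurl (hw : ∀ i, ContDiff ℝ (⊤ : ℕ∞) (w i)) (v : E) (i j : ι) :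
    dirDeriv v (dirCurl e w i j) = dirCurl e (fun i => dirDeriv v (w i)) i j := by
  funext p
  rw [show dirCurl e w i j = fun p => dirDeriv (e i) (w j) p - dirDeriv (e j) (w i) p from rfl,
    dirDeriv_sub (contDiff_dirDeriv (hw j) _) (contDiff_dirDeriv (hw i) _)]
  simp_rw [dirCurl, dirDeriv_comm (hw _) v]

variable [Fintype ι]

/-- Divergence of a family of functions with respect to a family of directions. -/
noncomputable def dirDiv (e : ι → E) (w : ι → E → ℝ) (p : E) : ℝ :=
  ∑ i, dirDeriv (e i) (w i) p

theorem contDiff_dirDiv (hw : ∀ i, ContDiff ℝ (⊤ : ℕ∞) (w i)) :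
    ContDiff ℝ (⊤ : ℕ∞) (dirDiv e w) :=
  ContDiff.sum fun i _ => contDiff_dirDeriv (hw i) _

theorem dirDiv_sub (hw : ∀ i, ContDiff ℝ (⊤ : ℕ∞) (w i))
    (hw' : ∀ i, ContDiff ℝ (⊤ : ℕ∞) (w' i)) :
    dirDiv e (fun i p => w i p - w' i p) = fun p => dirDiv e w p - dirDiv e w' p := by
  funext p
  simp_rw [dirDiv, dirDeriv_sub (hw _) (hw' _), Finset.sum_sub_distrib]

theorem dirDeriv_dirDiv (hw : ∀ i, ContDiff ℝ (⊤ : ℕ∞) (w i)) (v : E) :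
    dirDeriv v (dirDiv e w) = dirDiv e fun i => dirDeriv v (w i) := by
  funext p
  rw [show dirDiv e w = fun p => ∑ i, dirDeriv (e i) (w i) p from rfl,
    dirDeriv_sum fun i => contDiff_dirDeriv (hw i) _]
  simp_rw [dirDiv, dirDeriv_comm (hw _) v]

/-- Energy density of a displacement `w` and a temperature `φ`, with time direction `τ`. -/
noncomputable def energyDensity (τ : E) (e : ι → E) (a μ : ℝ) (w : ι → E → ℝ) (φ : E → ℝ) :
    E → ℝ := fun p =>
  1 / 2 * ∑ j, dirDeriv τ (w j) p ^ 2 + a / 2 * dirDiv e w p ^ 2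
    + μ / 4 * ∑ i, ∑ j, dirCurl e w i j p ^ 2 + 1 / 2 * φ p ^ 2

/-- Energy flux of a displacement `w` and a temperature `φ` coupled through `θ`. -/
noncomputable def energyFlux (τ : E) (e : ι → E) (a μ ν : ℝ) (w : ι → E → ℝ) (φ θ : E → ℝ)
    (i : ι) : E → ℝ := fun p =>
  a * (dirDiv e w p * dirDeriv τ (w i) p)
    - μ * ∑ j, dirDeriv τ (w j) p * dirCurl e w j i p
    + φ p * dirDeriv (e i) φ p - ν * (θ p * φ p * dirDeriv τ (w i) p)

variable {φ θ : E → ℝ}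

theorem contDiff_energyDensity (hw : ∀ i, ContDiff ℝ (⊤ : ℕ∞) (w i))
    (hφ : ContDiff ℝ (⊤ : ℕ∞) φ) (τ : E) (a μ : ℝ) :
    ContDiff ℝ (⊤ : ℕ∞) (energyDensity τ e a μ w φ) :=
  (((contDiff_const.mul (ContDiff.sum fun j _ => (contDiff_dirDeriv (hw j) τ).pow 2)).add
    (contDiff_const.mul ((contDiff_dirDiv hw).pow 2))).add
    (contDiff_const.mul (ContDiff.sum fun i _ => ContDiff.sum fun j _ =>
      (contDiff_dirCurl hw i j).pow 2))).add (contDiff_const.mul (hφ.pow 2))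

theorem contDiff_energyFlux (hw : ∀ i, ContDiff ℝ (⊤ : ℕ∞) (w i))
    (hφ : ContDiff ℝ (⊤ : ℕ∞) φ) (hθ : ContDiff ℝ (⊤ : ℕ∞) θ) (τ : E) (a μ ν : ℝ) (i : ι) :
    ContDiff ℝ (⊤ : ℕ∞) (energyFlux τ e a μ ν w φ θ i) :=
  (((contDiff_const.mul ((contDiff_dirDiv hw).mul (contDiff_dirDeriv (hw i) τ))).sub
    (contDiff_const.mul (ContDiff.sum fun j _ =>
      (contDiff_dirDeriv (hw j) τ).mul (contDiff_dirCurl hw j i)))).add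
    (hφ.mul (contDiff_dirDeriv hφ _))).sub
    (contDiff_const.mul ((hθ.mul hφ).mul (contDiff_dirDeriv (hw i) τ)))

theorem dirDeriv_energyDensity (hw : ∀ i, ContDiff ℝ (⊤ : ℕ∞) (w i))
    (hφ : ContDiff ℝ (⊤ : ℕ∞) φ) (τ : E) (a μ : ℝ) (p : E) :
    dirDeriv τ (energyDensity τ e a μ w φ) p =
      ∑ j, dirDeriv τ (w j) p * dirDeriv τ (dirDeriv τ (w j)) p
        + a * (dirDiv e w p * ∑ j, dirDeriv (e j) (dirDeriv τ (w j)) p)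
        + μ / 2 * ∑ i, ∑ j, dirCurl e w i j p *
          (dirDeriv (e i) (dirDeriv τ (w j)) p - dirDeriv (e j) (dirDeriv τ (w i)) p)
        + φ p * dirDeriv τ φ p := by
  have hv j := contDiff_dirDeriv (hw j) τ
  have hq : ContDiff ℝ (⊤ : ℕ∞) (dirDiv e w) := contDiff_dirDiv hw
  have hc i j : ContDiff ℝ (⊤ : ℕ∞) (dirCurl e w i j) := contDiff_dirCurl hw i j
  have h1 : ContDiff ℝ (⊤ : ℕ∞) fun p => ∑ j, dirDeriv τ (w j) p ^ 2 :=
    ContDiff.sum fun j _ => (hv j).pow 2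
  have h3' i : ContDiff ℝ (⊤ : ℕ∞) fun p => ∑ j, dirCurl e w i j p ^ 2 :=
    ContDiff.sum fun j _ => (hc i j).pow 2
  have h3 : ContDiff ℝ (⊤ : ℕ∞) fun p => ∑ i, ∑ j, dirCurl e w i j p ^ 2 :=
    ContDiff.sum fun i _ => h3' i
  unfold energyDensity
  rw [dirDeriv_add (((contDiff_const.mul h1).add (contDiff_const.mul (hq.pow 2))).add
      (contDiff_const.mul h3)) (contDiff_const.mul (hφ.pow 2)),
    dirDeriv_add ((contDiff_const.mul h1).add (contDiff_const.mul (hq.pow 2)))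
      (contDiff_const.mul h3),
    dirDeriv_add (contDiff_const.mul h1) (contDiff_const.mul (hq.pow 2)),
    dirDeriv_const_mul h1, dirDeriv_const_mul (hq.pow 2), dirDeriv_const_mul h3,
    dirDeriv_const_mul (hφ.pow 2), dirDeriv_sq hq, dirDeriv_sq hφ,
    dirDeriv_sum fun j => (hv j).pow 2, dirDeriv_sum h3', dirDeriv_dirDiv hw]
  simp_rw [dirDeriv_sum fun j => (hc _ j).pow 2, dirDeriv_sq (hc _ _), dirDeriv_sq (hv _),
    dirDeriv_dirCurl hw, ← Finset.mul_sum]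
  simp only [dirDiv, dirCurl]
  ring

theorem dirDeriv_energyFlux (hw : ∀ i, ContDiff ℝ (⊤ : ℕ∞) (w i))
    (hφ : ContDiff ℝ (⊤ : ℕ∞) φ) (hθ : ContDiff ℝ (⊤ : ℕ∞) θ) (τ : E) (a μ ν : ℝ) (p : E)
    (i : ι) :
    dirDeriv (e i) (energyFlux τ e a μ ν w φ θ i) p =
      a * (dirDiv e w p * dirDeriv (e i) (dirDeriv τ (w i)) p
        + dirDeriv τ (w i) p * dirDeriv (e i) (dirDiv e w) p)
      - μ * ∑ j, (dirDeriv τ (w j) p * dirDeriv (e i) (dirCurl e w j i) p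
        + dirCurl e w j i p * dirDeriv (e i) (dirDeriv τ (w j)) p)
      + (φ p * dirDeriv (e i) (dirDeriv (e i) φ) p + dirDeriv (e i) φ p * dirDeriv (e i) φ p)
      - ν * (θ p * φ p * dirDeriv (e i) (dirDeriv τ (w i)) p
        + dirDeriv τ (w i) p * (θ p * dirDeriv (e i) φ p + φ p * dirDeriv (e i) θ p)) := by
  have hv j := contDiff_dirDeriv (hw j) τ
  have hq : ContDiff ℝ (⊤ : ℕ∞) (dirDiv e w) := contDiff_dirDiv hw
  have hc i j : ContDiff ℝ (⊤ : ℕ∞) (dirCurl e w i j) := contDiff_dirCurl hw i j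
  have h1 := hq.mul (hv i)
  have h2 : ContDiff ℝ (⊤ : ℕ∞) fun p => ∑ j, dirDeriv τ (w j) p * dirCurl e w j i p :=
    ContDiff.sum fun j _ => (hv j).mul (hc j i)
  have h3 := hφ.mul (contDiff_dirDeriv hφ (e i))
  have h4 := (hθ.mul hφ).mul (hv i)
  unfold energyFlux
  rw [dirDeriv_sub (((contDiff_const.mul h1).sub (contDiff_const.mul h2)).add h3)
      (contDiff_const.mul h4),
    dirDeriv_add ((contDiff_const.mul h1).sub (contDiff_const.mul h2)) h3,
    dirDeriv_sub (contDiff_const.mul h1) (contDiff_const.mul h2),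
    dirDeriv_const_mul h1, dirDeriv_const_mul h2, dirDeriv_const_mul h4,
    dirDeriv_mul hq (hv i), dirDeriv_mul hφ (contDiff_dirDeriv hφ (e i)),
    dirDeriv_mul (hθ.mul hφ) (hv i), dirDeriv_mul hθ hφ,
    dirDeriv_sum fun j => (hv j).mul (hc j i)]
  simp_rw [dirDeriv_mul (hv _) (hc _ i)]

theorem sum_dirCurl_mul_sub (V : ι → ι → ℝ) (p : E) :
    ∑ i, ∑ j, dirCurl e w i j p * (V i j - V j i) = -2 * ∑ i, ∑ j, dirCurl e w j i p * V i j := by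
  have hanti i j : dirCurl e w i j p = -dirCurl e w j i p := by simp [dirCurl]
  simp_rw [mul_sub, Finset.sum_sub_distrib]
  rw [Finset.sum_comm (f := fun i j => dirCurl e w i j p * V j i)]
  have : ∑ i, ∑ j, dirCurl e w i j p * V i j = -∑ i, ∑ j, dirCurl e w j i p * V i j := by
    simp_rw [← Finset.sum_neg_distrib]
    exact Finset.sum_congr rfl fun i _ => Finset.sum_congr rfl fun j _ => by
      rw [hanti i j, neg_mul]
  rw [this]
  ring

/-- Local energy balance for the linearised difference system. -/
theorem energy_balance (hw : ∀ i, ContDiff ℝ (⊤ : ℕ∞) (w i))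
    (hφ : ContDiff ℝ (⊤ : ℕ∞) φ) (hθ : ContDiff ℝ (⊤ : ℕ∞) θ) {τ : E} {a μ ν D : ℝ} {p : E}
    (hwave : ∀ j, dirDeriv τ (dirDeriv τ (w j)) p = a * dirDeriv (e j) (dirDiv e w) p
      - μ * ∑ i, dirDeriv (e i) (dirCurl e w j i) p - ν * dirDeriv (e j) φ p)
    (hheat : dirDeriv τ φ p = ∑ i, dirDeriv (e i) (dirDeriv (e i) φ) p
      - ν * (φ p * D + θ p * ∑ i, dirDeriv (e i) (dirDeriv τ (w i)) p)) :
    dirDeriv τ (energyDensity τ e a μ w φ) p =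
      ∑ i, dirDeriv (e i) (energyFlux τ e a μ ν w φ θ i) p
        + (∑ i, (ν * (θ p - 1) * dirDeriv τ (w i) p * dirDeriv (e i) φ p
          - dirDeriv (e i) φ p ^ 2 + ν * φ p * dirDeriv (e i) θ p * dirDeriv τ (w i) p)
          - ν * φ p ^ 2 * D) := by
  rw [dirDeriv_energyDensity hw hφ,
    sum_dirCurl_mul_sub (fun i j => dirDeriv (e i) (dirDeriv τ (w j)) p)]
  simp_rw [dirDeriv_energyFlux hw hφ hθ, hwave, hheat]
  have hswap : ∑ j, dirDeriv τ (w j) p * ∑ i, dirDeriv (e i) (dirCurl e w j i) p =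
      ∑ i, ∑ j, dirDeriv τ (w j) p * dirDeriv (e i) (dirCurl e w j i) p := by
    simp_rw [Finset.mul_sum]
    exact Finset.sum_comm
  have hlin : ∑ j, dirDeriv τ (w j) p * (a * dirDeriv (e j) (dirDiv e w) p
      - μ * ∑ i, dirDeriv (e i) (dirCurl e w j i) p - ν * dirDeriv (e j) φ p) =
      a * ∑ j, dirDeriv τ (w j) p * dirDeriv (e j) (dirDiv e w) p
      - μ * ∑ i, ∑ j, dirDeriv τ (w j) p * dirDeriv (e i) (dirCurl e w j i) p
      - ν * ∑ j, dirDeriv τ (w j) p * dirDeriv (e j) φ p := by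
    rw [← hswap, Finset.mul_sum, Finset.mul_sum, Finset.mul_sum, ← Finset.sum_sub_distrib,
      ← Finset.sum_sub_distrib]
    exact Finset.sum_congr rfl fun j _ => by ring
  rw [hlin]
  simp only [Finset.sum_add_distrib, Finset.sum_sub_distrib, ← Finset.mul_sum, mul_add, mul_sub]
  have r1 : ∑ i, dirDeriv τ (w i) p * (θ p * dirDeriv (e i) φ p) =
    θ p * ∑ i, dirDeriv τ (w i) p * dirDeriv (e i) φ p := by
    rw [Finset.mul_sum]; exact Finset.sum_congr rfl fun i _ => by ring
  have r2 : ∑ i, dirDeriv τ (w i) p * (φ p * dirDeriv (e i) θ p) =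
    φ p * ∑ i, dirDeriv τ (w i) p * dirDeriv (e i) θ p := by
    rw [Finset.mul_sum]; exact Finset.sum_congr rfl fun i _ => by ring
  have r3 : ∑ i, (ν * θ p - ν * 1) * dirDeriv τ (w i) p * dirDeriv (e i) φ p =
    (ν * θ p - ν) * ∑ i, dirDeriv τ (w i) p * dirDeriv (e i) φ p := by
    rw [Finset.mul_sum]; exact Finset.sum_congr rfl fun i _ => by ring
  have r4 : ∑ i, ν * φ p * dirDeriv (e i) θ p * dirDeriv τ (w i) p =
    ν * φ p * ∑ i, dirDeriv τ (w i) p * dirDeriv (e i) θ p := by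
    rw [Finset.mul_sum]; exact Finset.sum_congr rfl fun i _ => by ring
  have r5 : ∑ i, dirDeriv (e i) φ p * dirDeriv (e i) φ p = ∑ i, dirDeriv (e i) φ p ^ 2 :=
    Finset.sum_congr rfl fun i _ => by ring
  rw [r1, r2, r3, r4, r5]
  ring

end DirectionalDerivative

section SpaceTime

variable {d : ℕ}

/-- The time direction in space-time. -/
def timeDir (d : ℕ) : ℝ × Ed d := (1, 0)

/-- The coordinate directions in space-time. -/
noncomputable def spaceDir (i : Fin d) : ℝ × Ed d := (0, EuclideanSpace.single i 1)

theorem hasDerivAt_time {f : ℝ × Ed d → ℝ} (hf : ContDiff ℝ (⊤ : ℕ∞) f) (t : ℝ) (x : Ed d) :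
    HasDerivAt (fun s => f (s, x)) (dirDeriv (timeDir d) f (t, x)) t := by
  have h := (hf.differentiable_of_top (t, x)).hasFDerivAt.comp_hasDerivAt t
    ((hasDerivAt_id t).prodMk (hasDerivAt_const t x))
  exact h

theorem pd_slice {f : ℝ × Ed d → ℝ} (hf : ContDiff ℝ (⊤ : ℕ∞) f) (i : Fin d) (t : ℝ)
    (x : Ed d) : pd i (fun y => f (t, y)) x = dirDeriv (spaceDir i) f (t, x) := by
  have h := (hf.differentiable_of_top (t, x)).hasFDerivAt.comp x (hasFDerivAt_prodMk_right t x)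
  change fderiv ℝ (f ∘ fun y => (t, y)) x _ = _
  rw [h.fderiv]
  rfl

theorem tder_eq_dirDeriv {f : ℝ → Ed d → ℝ}
    (hf : ContDiff ℝ (⊤ : ℕ∞) fun p : ℝ × Ed d => f p.1 p.2) (t : ℝ) (x : Ed d) :
    tder f t x = dirDeriv (timeDir d) (fun p => f p.1 p.2) (t, x) :=
  (hasDerivAt_time hf t x).deriv

variable {u : ℝ → Ed d → Ed d}

theorem contDiff_coord (hu : ContDiff ℝ (⊤ : ℕ∞) fun p : ℝ × Ed d => u p.1 p.2) (j : Fin d) :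
    ContDiff ℝ (⊤ : ℕ∞) fun p : ℝ × Ed d => u p.1 p.2 j :=
  contDiff_euclidean.1 hu j

theorem hasDerivAt_tder (hu : ContDiff ℝ (⊤ : ℕ∞) fun p : ℝ × Ed d => u p.1 p.2) (t : ℝ)
    (x : Ed d) : HasDerivAt (fun s => u s x)
      (fderiv ℝ (fun p : ℝ × Ed d => u p.1 p.2) (t, x) (1, 0)) t := by
  have h := (hu.differentiable (by simp) (t, x)).hasFDerivAt.comp_hasDerivAt t
    ((hasDerivAt_id t).prodMk (hasDerivAt_const t x))
  exact h

theorem contDiff_tder (hu : ContDiff ℝ (⊤ : ℕ∞) fun p : ℝ × Ed d => u p.1 p.2) :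
    ContDiff ℝ (⊤ : ℕ∞) fun p : ℝ × Ed d => tder u p.1 p.2 := by
  have : (fun p : ℝ × Ed d => tder u p.1 p.2) =
      fun p => fderiv ℝ (fun p : ℝ × Ed d => u p.1 p.2) p (1, 0) := by
    funext p
    exact (hasDerivAt_tder hu p.1 p.2).deriv
  rw [this]
  exact (hu.fderiv_right (m := (⊤ : ℕ∞)) (by simp)).clm_apply contDiff_const

theorem tder_apply (hu : ContDiff ℝ (⊤ : ℕ∞) fun p : ℝ × Ed d => u p.1 p.2) (t : ℝ) (x : Ed d)
    (j : Fin d) :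
    tder u t x j = dirDeriv (timeDir d) (fun p => u p.1 p.2 j) (t, x) := by
  rw [tder, (hasDerivAt_tder hu t x).deriv]
  exact ((EuclideanSpace.proj (𝕜 := ℝ) j).hasFDerivAt.comp_hasDerivAt t
    (hasDerivAt_tder hu t x)).unique (hasDerivAt_time (contDiff_coord hu j) t x)

theorem tder_tder_apply (hu : ContDiff ℝ (⊤ : ℕ∞) fun p : ℝ × Ed d => u p.1 p.2) (t : ℝ)
    (x : Ed d) (j : Fin d) :
    tder (tder u) t x j =
      dirDeriv (timeDir d) (dirDeriv (timeDir d) fun p => u p.1 p.2 j) (t, x) := by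
  rw [tder_apply (contDiff_tder hu)]
  simp_rw [tder_apply hu]

theorem divg_slice (hu : ContDiff ℝ (⊤ : ℕ∞) fun p : ℝ × Ed d => u p.1 p.2) (t : ℝ)
    (x : Ed d) : divg (u t) x = dirDiv spaceDir (fun j p => u p.1 p.2 j) (t, x) :=
  Finset.sum_congr rfl fun i _ => pd_slice (contDiff_coord hu i) i t x

theorem divg_tder (hu : ContDiff ℝ (⊤ : ℕ∞) fun p : ℝ × Ed d => u p.1 p.2) (t : ℝ)
    (x : Ed d) : divg (tder u t) x =
      ∑ i, dirDeriv (spaceDir i) (dirDeriv (timeDir d) fun p => u p.1 p.2 i) (t, x) := by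
  rw [divg_slice (contDiff_tder hu)]
  simp_rw [tder_apply hu]
  rfl

theorem curlM_slice (hu : ContDiff ℝ (⊤ : ℕ∞) fun p : ℝ × Ed d => u p.1 p.2) (t : ℝ)
    (x : Ed d) (i j : Fin d) :
    curlM (u t) x i j = dirCurl spaceDir (fun j p => u p.1 p.2 j) i j (t, x) := by
  rw [curlM, dirCurl, ← pd_slice (contDiff_coord hu j), ← pd_slice (contDiff_coord hu i)]

theorem pd_divg_slice (hu : ContDiff ℝ (⊤ : ℕ∞) fun p : ℝ × Ed d => u p.1 p.2) (t : ℝ)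
    (x : Ed d) (j : Fin d) : pd j (divg (u t)) x =
      dirDeriv (spaceDir j) (dirDiv spaceDir fun j p => u p.1 p.2 j) (t, x) := by
  rw [← pd_slice (contDiff_dirDiv (contDiff_coord hu)) j]
  congr 1
  funext y
  exact divg_slice hu t y

theorem ccurl_slice (hu : ContDiff ℝ (⊤ : ℕ∞) fun p : ℝ × Ed d => u p.1 p.2) (t : ℝ)
    (x : Ed d) (j : Fin d) : ccurl (u t) x j =
      ∑ i, dirDeriv (spaceDir i) (dirCurl spaceDir (fun j p => u p.1 p.2 j) j i) (t, x) := by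
  refine Finset.sum_congr rfl fun i _ => ?_
  rw [← pd_slice (contDiff_dirCurl (contDiff_coord hu) j i)]
  congr 1
  funext y
  exact curlM_slice hu t y j i

theorem lap_slice {f : ℝ → Ed d → ℝ}
    (hf : ContDiff ℝ (⊤ : ℕ∞) fun p : ℝ × Ed d => f p.1 p.2) (t : ℝ) (x : Ed d) :
    lap (f t) x =
      ∑ i, dirDeriv (spaceDir i) (dirDeriv (spaceDir i) fun p => f p.1 p.2) (t, x) := by
  refine Finset.sum_congr rfl fun i _ => ?_
  rw [← pd_slice (contDiff_dirDeriv hf _)]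
  congr 1
  funext y
  exact pd_slice hf i t y

theorem integrableOn_slice {G : ℝ × Ed d → ℝ} (hG : Continuous G) {Ω : Set (Ed d)}
    (hb : Bornology.IsBounded Ω) (t : ℝ) : IntegrableOn (fun x => G (t, x)) Ω :=
  ((hG.comp (Continuous.prodMk_right t)).continuousOn.integrableOn_compact
    hb.isCompact_closure).mono_set subset_closure

/-- Differentiation under the integral sign for smooth functions on bounded domains. -/
theorem hasDerivAt_setIntegral {G : ℝ × Ed d → ℝ} (hG : ContDiff ℝ (⊤ : ℕ∞) G)
    {Ω : Set (Ed d)} (ho : IsOpen Ω) (hb : Bornology.IsBounded Ω) (t : ℝ) :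
    HasDerivAt (fun s => ∫ x in Ω, G (s, x)) (∫ x in Ω, dirDeriv (timeDir d) G (t, x)) t := by
  have hcont : Continuous (dirDeriv (timeDir d) G) := (contDiff_dirDeriv hG _).continuous
  obtain ⟨C, hC⟩ := ((isCompact_Icc (a := t - 1) (b := t + 1)).prod
    hb.isCompact_closure).exists_bound_of_continuousOn hcont.continuousOn
  refine (hasDerivAt_integral_of_dominated_loc_of_deriv_le
    (bound := fun _ => C) (F' := fun s x => dirDeriv (timeDir d) G (s, x))
    (Icc_mem_nhds (by linarith : t - 1 < t) (by linarith : t < t + 1))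
    (.of_forall fun s => (integrableOn_slice hG.continuous hb s).1)
    (integrableOn_slice hG.continuous hb t) (integrableOn_slice hcont hb t).1
    ?_ (integrableOn_const hb.measure_lt_top.ne) (.of_forall fun x s _ => hasDerivAt_time hG s x)).2
  filter_upwards [ae_restrict_mem ho.measurableSet] with x hx s hs
  exact hC (s, x) ⟨hs, subset_closure hx⟩

end SpaceTime

/-- Gronwall: a nonnegative function vanishing initially with `E' ≤ C E` vanishes. -/
theorem eq_zero_of_deriv_le_mul {E E' : ℝ → ℝ} {C T : ℝ} (hE : ∀ t, HasDerivAt E (E' t) t)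
    (h0 : E 0 = 0) (hnonneg : ∀ t, 0 ≤ E t)
    (hle : ∀ t ∈ Ioo 0 T, E' t ≤ C * E t) {t : ℝ} (ht : t ∈ Icc 0 T) : E t = 0 := by
  have hd (s : ℝ) : HasDerivAt (fun s => E s * exp (-C * s))
      (E' s * exp (-C * s) + E s * (exp (-C * s) * (-C * 1))) s :=
    (hE s).mul ((hasDerivAt_id s).const_mul (-C)).exp
  have hanti : AntitoneOn (fun s => E s * exp (-C * s)) (Icc 0 T) := by
    refine antitoneOn_of_deriv_nonpos (convex_Icc 0 T)
      (fun s _ => (hd s).continuousAt.continuousWithinAt)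
      (fun s _ => (hd s).differentiableAt.differentiableWithinAt) fun s hs => ?_
    rw [interior_Icc] at hs
    rw [(hd s).deriv]
    nlinarith [hle s hs, exp_pos (-C * s)]
  have h := hanti (left_mem_Icc.2 (ht.1.trans ht.2)) ht ht.1
  simp only [h0, zero_mul] at h
  exact le_antisymm (nonpos_of_mul_nonpos_left h (exp_pos _)) (hnonneg t)

/-- Young-type bound for the remainder in the energy balance. -/
theorem remainder_le {ι : Type*} [Fintype ι] (ν θ φ D : ℝ) (v p q : ι → ℝ) :
    ∑ i, (ν * (θ - 1) * v i * p i - p i ^ 2 + ν * φ * q i * v i) - ν * φ ^ 2 * D ≤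
      (1 + ν ^ 2 * (θ - 1) ^ 2 + ν ^ 2 * ∑ i, q i ^ 2 + 2 * |ν * D|) *
        (1 / 2 * ∑ i, v i ^ 2 + 1 / 2 * φ ^ 2) := by
  have h1 : ∑ i, (ν * (θ - 1) * v i * p i - p i ^ 2 + ν * φ * q i * v i) ≤
      ∑ i, ((1 / 2 + ν ^ 2 * (θ - 1) ^ 2 / 4) * v i ^ 2 + ν ^ 2 * φ ^ 2 / 2 * q i ^ 2) :=
    Finset.sum_le_sum fun i _ => by
      nlinarith [sq_nonneg (ν * (θ - 1) * v i / 2 - p i), sq_nonneg (ν * φ * q i - v i)]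
  rw [Finset.sum_add_distrib (f := fun i => (1 / 2 + ν ^ 2 * (θ - 1) ^ 2 / 4) * v i ^ 2),
    ← Finset.mul_sum, ← Finset.mul_sum] at h1
  have hv : 0 ≤ ∑ i, v i ^ 2 := Finset.sum_nonneg fun i _ => sq_nonneg _
  have hq : 0 ≤ ∑ i, q i ^ 2 := Finset.sum_nonneg fun i _ => sq_nonneg _
  have h2 : -(ν * φ ^ 2 * D) ≤ |ν * D| * φ ^ 2 := by
    nlinarith [neg_abs_le (ν * D), sq_nonneg φ]
  have h3 : 0 ≤ ν ^ 2 * (θ - 1) ^ 2 := by positivity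
  have h4 : 0 ≤ ν ^ 2 * ∑ i, q i ^ 2 := by positivity
  have h5 := abs_nonneg (ν * D)
  nlinarith [mul_nonneg h3 hv, mul_nonneg h3 (sq_nonneg φ), mul_nonneg h4 hv,
    mul_nonneg h5 hv, sq_nonneg φ]

theorem GoodDomain.compl_nonempty {d : ℕ} {Ω : Set (Ed d)} {n : Ed d → Ed d}
    (h : GoodDomain d Ω n) : Ωᶜ.Nonempty := by
  rw [nonempty_compl]
  rintro rfl
  have : Nonempty (Fin d) := ⟨⟨0, by rcases h.dims with h | h <;> omega⟩⟩
  have : NoncompactSpace (Ed d) := NormedSpace.noncompactSpace ℝ (Ed d)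
  exact noncompact_univ (Ed d) (by simpa using h.bounded.isCompact_closure)

theorem energyDensity_ge {E ι : Type*} [NormedAddCommGroup E] [NormedSpace ℝ E] [Fintype ι]
    {τ : E} {e : ι → E} {a μ : ℝ} (ha : 0 ≤ a) (hμ : 0 ≤ μ) (w : ι → E → ℝ) (φ : E → ℝ) (p : E) :
    1 / 2 * ∑ j, dirDeriv τ (w j) p ^ 2 + 1 / 2 * φ p ^ 2 ≤ energyDensity τ e a μ w φ p := by
  have h1 : 0 ≤ a / 2 * dirDiv e w p ^ 2 := by positivity
  have h2 : 0 ≤ μ / 4 * ∑ i, ∑ j, dirCurl e w i j p ^ 2 := by positivity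
  unfold energyDensity
  linarith

namespace IsSolution

variable {d : ℕ} {Ω : Set (Ed d)} {n : Ed d → Ed d} {μ lam ν : ℝ}
  {u u₁ u₂ : ℝ → Ed d → Ed d} {θ θ₁ θ₂ : ℝ → Ed d → ℝ}

theorem wave_dirDeriv (h : IsSolution Ω n μ lam ν u θ) {t : ℝ} (ht : 0 < t) {x : Ed d}
    (hx : x ∈ Ω) (j : Fin d) :
    dirDeriv (timeDir d) (dirDeriv (timeDir d) fun p => u p.1 p.2 j) (t, x) =
      (2 * μ + lam) * dirDeriv (spaceDir j) (dirDiv spaceDir fun j p => u p.1 p.2 j) (t, x)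
      - μ * ∑ i, dirDeriv (spaceDir i) (dirCurl spaceDir (fun j p => u p.1 p.2 j) j i) (t, x)
      - ν * dirDeriv (spaceDir j) (fun p => θ p.1 p.2) (t, x) := by
  have := h.wave t ht x hx j
  rw [tder_tder_apply h.smooth_u, pd_divg_slice h.smooth_u, ccurl_slice h.smooth_u] at this
  rw [← pd_slice h.smooth_θ]
  linarith

theorem heat_dirDeriv (h : IsSolution Ω n μ lam ν u θ) {t : ℝ} (ht : 0 < t) {x : Ed d}
    (hx : x ∈ Ω) :
    dirDeriv (timeDir d) (fun p => θ p.1 p.2) (t, x) =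
      ∑ i, dirDeriv (spaceDir i) (dirDeriv (spaceDir i) fun p => θ p.1 p.2) (t, x)
      - ν * (θ t x *
        ∑ i, dirDeriv (spaceDir i) (dirDeriv (timeDir d) fun p => u p.1 p.2 i) (t, x)) := by
  have := h.heat t ht x hx
  rw [tder_eq_dirDeriv h.smooth_θ, lap_slice h.smooth_θ, divg_tder h.smooth_u] at this
  linarith

variable (u₁ u₂ θ₁ θ₂) in
/-- The coordinates of the difference of two displacements. -/
def diffDisp (j : Fin d) (p : ℝ × Ed d) : ℝ := u₁ p.1 p.2 j - u₂ p.1 p.2 j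

variable (θ₁ θ₂) in
/-- The difference of two temperatures. -/
def diffTemp (p : ℝ × Ed d) : ℝ := θ₁ p.1 p.2 - θ₂ p.1 p.2

theorem contDiff_diffDisp (h₁ : IsSolution Ω n μ lam ν u₁ θ₁)
    (h₂ : IsSolution Ω n μ lam ν u₂ θ₂) (j : Fin d) :
    ContDiff ℝ (⊤ : ℕ∞) (diffDisp u₁ u₂ j) :=
  (contDiff_coord h₁.smooth_u j).sub (contDiff_coord h₂.smooth_u j)

theorem contDiff_diffTemp (h₁ : IsSolution Ω n μ lam ν u₁ θ₁)
    (h₂ : IsSolution Ω n μ lam ν u₂ θ₂) : ContDiff ℝ (⊤ : ℕ∞) (diffTemp θ₁ θ₂) :=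
  h₁.smooth_θ.sub h₂.smooth_θ

theorem wave_diff (h₁ : IsSolution Ω n μ lam ν u₁ θ₁) (h₂ : IsSolution Ω n μ lam ν u₂ θ₂)
    {t : ℝ} (ht : 0 < t) {x : Ed d} (hx : x ∈ Ω) (j : Fin d) :
    dirDeriv (timeDir d) (dirDeriv (timeDir d) (diffDisp u₁ u₂ j)) (t, x) =
      (2 * μ + lam) * dirDeriv (spaceDir j) (dirDiv spaceDir (diffDisp u₁ u₂)) (t, x)
      - μ * ∑ i, dirDeriv (spaceDir i) (dirCurl spaceDir (diffDisp u₁ u₂) j i) (t, x)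
      - ν * dirDeriv (spaceDir j) (diffTemp θ₁ θ₂) (t, x) := by
  have hu₁ := contDiff_coord h₁.smooth_u
  have hu₂ := contDiff_coord h₂.smooth_u
  change dirDeriv _ (dirDeriv _ fun p : ℝ × Ed d => u₁ p.1 p.2 j - u₂ p.1 p.2 j) _ =
    _ * dirDeriv _ (dirDiv _ fun j (p : ℝ × Ed d) => u₁ p.1 p.2 j - u₂ p.1 p.2 j) _ -
    μ * ∑ i, dirDeriv _ (dirCurl _ (fun j (p : ℝ × Ed d) => u₁ p.1 p.2 j - u₂ p.1 p.2 j) j i) _ -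
    ν * dirDeriv _ (fun p : ℝ × Ed d => θ₁ p.1 p.2 - θ₂ p.1 p.2) _
  rw [dirDeriv_sub (hu₁ j) (hu₂ j),
    dirDeriv_sub (contDiff_dirDeriv (hu₁ j) _) (contDiff_dirDeriv (hu₂ j) _),
    dirDiv_sub hu₁ hu₂, dirDeriv_sub (contDiff_dirDiv hu₁) (contDiff_dirDiv hu₂),
    dirDeriv_sub h₁.smooth_θ h₂.smooth_θ]
  simp_rw [dirCurl_sub hu₁ hu₂, dirDeriv_sub (contDiff_dirCurl hu₁ j _)
    (contDiff_dirCurl hu₂ j _), Finset.sum_sub_distrib, h₁.wave_dirDeriv ht hx j,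
    h₂.wave_dirDeriv ht hx j]
  ring

theorem heat_diff (h₁ : IsSolution Ω n μ lam ν u₁ θ₁) (h₂ : IsSolution Ω n μ lam ν u₂ θ₂)
    {t : ℝ} (ht : 0 < t) {x : Ed d} (hx : x ∈ Ω) :
    dirDeriv (timeDir d) (diffTemp θ₁ θ₂) (t, x) =
      ∑ i, dirDeriv (spaceDir i) (dirDeriv (spaceDir i) (diffTemp θ₁ θ₂)) (t, x)
      - ν * (diffTemp θ₁ θ₂ (t, x) * dirDiv spaceDir
          (fun i => dirDeriv (timeDir d) fun p => u₂ p.1 p.2 i) (t, x)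
        + θ₁ t x * ∑ i, dirDeriv (spaceDir i) (dirDeriv (timeDir d) (diffDisp u₁ u₂ i))
          (t, x)) := by
  have hu₁ := contDiff_coord h₁.smooth_u
  have hu₂ := contDiff_coord h₂.smooth_u
  have hθ₁ := h₁.smooth_θ
  have hθ₂ := h₂.smooth_θ
  unfold diffTemp diffDisp
  simp_rw [dirDeriv_sub (hu₁ _) (hu₂ _),
    dirDeriv_sub (contDiff_dirDeriv (hu₁ _) _) (contDiff_dirDeriv (hu₂ _) _),
    dirDeriv_sub hθ₁ hθ₂, dirDeriv_sub (contDiff_dirDeriv hθ₁ _) (contDiff_dirDeriv hθ₂ _),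
    Finset.sum_sub_distrib, h₁.heat_dirDeriv ht hx, h₂.heat_dirDeriv ht hx, dirDiv]
  ring

theorem sum_dirDeriv_time_mul_normal (h : IsSolution Ω n μ lam ν u θ) {t : ℝ} (ht : 0 < t)
    {x : Ed d} (hx : x ∈ frontier Ω) :
    ∑ i, dirDeriv (timeDir d) (fun p => u p.1 p.2 i) (t, x) * n x i = 0 := by
  have hd : HasDerivAt (fun s => ∑ i, u s x i * n x i)
      (∑ i, dirDeriv (timeDir d) (fun p => u p.1 p.2 i) (t, x) * n x i) t :=
    HasDerivAt.fun_sum fun i _ =>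
      (hasDerivAt_time (contDiff_coord h.smooth_u i) t x).mul_const (n x i)
  refine hd.unique ((hasDerivAt_const t (0 : ℝ)).congr_of_eventuallyEq ?_)
  filter_upwards [Ioi_mem_nhds ht] with s hs
  exact h.bc_u s hs x hx

theorem sum_energyFlux_mul_normal (h₁ : IsSolution Ω n μ lam ν u₁ θ₁)
    (h₂ : IsSolution Ω n μ lam ν u₂ θ₂) {t : ℝ} (ht : 0 < t) {x : Ed d} (hx : x ∈ frontier Ω)
    (a : ℝ) (f : ℝ × Ed d → ℝ) :
    ∑ i, energyFlux (timeDir d) spaceDir a μ ν (diffDisp u₁ u₂) (diffTemp θ₁ θ₂) f i (t, x)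
      * n x i = 0 := by
  have hu₁ := contDiff_coord h₁.smooth_u
  have hu₂ := contDiff_coord h₂.smooth_u
  have hv : ∑ i, dirDeriv (timeDir d) (diffDisp u₁ u₂ i) (t, x) * n x i = 0 := by
    unfold diffDisp
    simp_rw [dirDeriv_sub (hu₁ _) (hu₂ _), sub_mul, Finset.sum_sub_distrib,
      h₁.sum_dirDeriv_time_mul_normal ht hx, h₂.sum_dirDeriv_time_mul_normal ht hx, sub_zero]
  have hc (j : Fin d) : ∑ i, dirCurl spaceDir (diffDisp u₁ u₂) j i (t, x) * n x i = 0 := by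
    change ∑ i, dirCurl spaceDir (fun j p => u₁ p.1 p.2 j - u₂ p.1 p.2 j) j i (t, x) * n x i = 0
    simp_rw [dirCurl_sub hu₁ hu₂, sub_mul, Finset.sum_sub_distrib, ← curlM_slice h₁.smooth_u,
      ← curlM_slice h₂.smooth_u, h₁.bc_N t ht x hx j, h₂.bc_N t ht x hx j, sub_zero]
  have hφ : ∑ i, dirDeriv (spaceDir i) (diffTemp θ₁ θ₂) (t, x) * n x i = 0 := by
    unfold diffTemp
    simp_rw [dirDeriv_sub h₁.smooth_θ h₂.smooth_θ, sub_mul, Finset.sum_sub_distrib,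
      ← pd_slice h₁.smooth_θ, ← pd_slice h₂.smooth_θ, h₁.bc_θ t ht x hx, h₂.bc_θ t ht x hx,
      sub_zero]
  have hcv : ∑ i, (∑ j, dirDeriv (timeDir d) (diffDisp u₁ u₂ j) (t, x) *
      dirCurl spaceDir (diffDisp u₁ u₂) j i (t, x)) * n x i = 0 := by
    simp_rw [Finset.sum_mul]
    rw [Finset.sum_comm]
    simp_rw [mul_assoc, ← Finset.mul_sum, hc, mul_zero, Finset.sum_const_zero]
  have hterm (i : Fin d) :
      energyFlux (timeDir d) spaceDir a μ ν (diffDisp u₁ u₂) (diffTemp θ₁ θ₂) f i (t, x) * n x i =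
        (a * dirDiv spaceDir (diffDisp u₁ u₂) (t, x) - ν * (f (t, x) * diffTemp θ₁ θ₂ (t, x))) *
          (dirDeriv (timeDir d) (diffDisp u₁ u₂ i) (t, x) * n x i)
        - μ * ((∑ j, dirDeriv (timeDir d) (diffDisp u₁ u₂ j) (t, x) *
          dirCurl spaceDir (diffDisp u₁ u₂) j i (t, x)) * n x i)
        + diffTemp θ₁ θ₂ (t, x) *
          (dirDeriv (spaceDir i) (diffTemp θ₁ θ₂) (t, x) * n x i) := by
    unfold energyFlux
    ring
  simp_rw [hterm, Finset.sum_add_distrib, Finset.sum_sub_distrib, ← Finset.mul_sum, hv, hcv, hφ]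
  ring

variable (u₁ u₂ θ₁ θ₂) in
/-- Energy density of the difference of two solutions. -/
noncomputable def diffEnergy (μ lam : ℝ) : ℝ × Ed d → ℝ :=
  energyDensity (timeDir d) spaceDir (2 * μ + lam) μ (diffDisp u₁ u₂) (diffTemp θ₁ θ₂)

theorem setIntegral_sum_dirDeriv_eq_zero (hdom : GoodDomain d Ω n) {H : Fin d → ℝ × Ed d → ℝ}
    (hH : ∀ i, ContDiff ℝ (⊤ : ℕ∞) (H i)) {t : ℝ}
    (hn : ∀ x ∈ frontier Ω, ∑ i, H i (t, x) * n x i = 0) :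
    ∫ x in Ω, ∑ i, dirDeriv (spaceDir i) (H i) (t, x) = 0 := by
  have h := setIntegral_divg_eq_zero hdom.isOpen hdom.bounded hdom.compl_nonempty
    hdom.normal_unit
    (fun x hx y hy => by
      rw [← sum_mul_eq_inner]; exact hdom.normal_outward x hx y hy)
    (F := fun x => WithLp.toLp 2 fun i => H i (t, x))
    (contDiff_euclidean.2 fun i =>
      ((hH i).comp (contDiff_prodMk_right t)).of_le (by simp))
    (fun x hx => by rw [← sum_mul_eq_inner]; exact hn x hx)
  rw [← h]
  congr 1
  funext x
  exact Finset.sum_congr rfl fun i _ => (pd_slice (hH i) i t x).symm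

theorem exists_setIntegral_dirDeriv_diffEnergy_le (hdom : GoodDomain d Ω n) (hμ : 0 ≤ μ)
    (ha : 0 ≤ 2 * μ + lam) (h₁ : IsSolution Ω n μ lam ν u₁ θ₁)
    (h₂ : IsSolution Ω n μ lam ν u₂ θ₂) (T : ℝ) :
    ∃ C, ∀ t ∈ Ioo 0 T,
      ∫ x in Ω, dirDeriv (timeDir d) (diffEnergy u₁ u₂ θ₁ θ₂ μ lam) (t, x) ≤
        C * ∫ x in Ω, diffEnergy u₁ u₂ θ₁ θ₂ μ lam (t, x) := by
  have hw := h₁.contDiff_diffDisp h₂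
  have hφ := h₁.contDiff_diffTemp h₂
  have hθ := h₁.smooth_θ
  set w := diffDisp u₁ u₂
  set φ := diffTemp θ₁ θ₂
  set Θ : ℝ × Ed d → ℝ := fun p => θ₁ p.1 p.2 with hΘ
  let D : ℝ × Ed d → ℝ :=
    dirDiv spaceDir fun i => dirDeriv (timeDir d) fun p => u₂ p.1 p.2 i
  have hD : ContDiff ℝ (⊤ : ℕ∞) D :=
    contDiff_dirDiv fun i => contDiff_dirDeriv (contDiff_coord h₂.smooth_u i) _
  let H := energyFlux (timeDir d) spaceDir (2 * μ + lam) μ ν w φ Θ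
  have hH (i : Fin d) : ContDiff ℝ (⊤ : ℕ∞) (H i) := contDiff_energyFlux hw hφ hθ _ _ _ _ i
  have hEn : ContDiff ℝ (⊤ : ℕ∞) (diffEnergy u₁ u₂ θ₁ θ₂ μ lam) :=
    contDiff_energyDensity hw hφ _ _ _
  let k : ℝ × Ed d → ℝ := fun p => 1 + ν ^ 2 * (Θ p - 1) ^ 2
    + ν ^ 2 * ∑ i, dirDeriv (spaceDir i) Θ p ^ 2 + 2 * |ν * D p|
  have hk : Continuous k := by
    have h1 := hθ.continuous
    have h2 := hD.continuous
    have h3 (i : Fin d) := (contDiff_dirDeriv hθ (spaceDir i)).continuous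
    fun_prop
  obtain ⟨C, hC⟩ := ((isCompact_Icc (a := 0) (b := T)).prod
    hdom.bounded.isCompact_closure).exists_bound_of_continuousOn hk.continuousOn
  refine ⟨C, fun t ht => ?_⟩
  have hdivc : Continuous fun p => ∑ i, dirDeriv (spaceDir i) (H i) p :=
    (ContDiff.sum fun i _ => contDiff_dirDeriv (hH i) _).continuous
  calc ∫ x in Ω, dirDeriv (timeDir d) (diffEnergy u₁ u₂ θ₁ θ₂ μ lam) (t, x)
      ≤ ∫ x in Ω, (∑ i, dirDeriv (spaceDir i) (H i) (t, x)
          + C * diffEnergy u₁ u₂ θ₁ θ₂ μ lam (t, x)) := by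
        refine setIntegral_mono_on
          (integrableOn_slice (contDiff_dirDeriv hEn _).continuous hdom.bounded t)
          ((integrableOn_slice hdivc hdom.bounded t).add
            ((integrableOn_slice hEn.continuous hdom.bounded t).const_mul C))
          hdom.isOpen.measurableSet fun x hx => ?_
        have hbal := energy_balance hw hφ hθ (D := D (t, x)) (h₁.wave_diff h₂ ht.1 hx)
          (h₁.heat_diff h₂ ht.1 hx)
        have hrem := remainder_le ν (Θ (t, x)) (φ (t, x)) (D (t, x))
          (fun i => dirDeriv (timeDir d) (w i) (t, x))
          (fun i => dirDeriv (spaceDir i) φ (t, x)) (fun i => dirDeriv (spaceDir i) Θ (t, x))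
        have hge := energyDensity_ge (τ := timeDir d) (e := spaceDir) ha hμ w φ (t, x)
        have hkC : k (t, x) ≤ C :=
          (le_abs_self _).trans (hC (t, x) ⟨Ioo_subset_Icc_self ht, subset_closure hx⟩)
        have hC0 : 0 ≤ C :=
          (norm_nonneg _).trans (hC (t, x) ⟨Ioo_subset_Icc_self ht, subset_closure hx⟩)
        unfold diffEnergy
        rw [hbal]
        refine add_le_add le_rfl (hrem.trans ?_)
        exact mul_le_mul hkC hge (by positivity) hC0
    _ = C * ∫ x in Ω, diffEnergy u₁ u₂ θ₁ θ₂ μ lam (t, x) := by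
        rw [integral_add (integrableOn_slice hdivc hdom.bounded t)
            ((integrableOn_slice hEn.continuous hdom.bounded t).const_mul C),
          setIntegral_sum_dirDeriv_eq_zero hdom hH fun x hx =>
            h₁.sum_energyFlux_mul_normal h₂ ht.1 hx _ _,
          integral_const_mul, zero_add]

end IsSolution

theorem pd_eq_zero_of_eqOn {d : ℕ} {Ω : Set (Ed d)} (ho : IsOpen Ω) {f : Ed d → ℝ}
    (hf : ∀ x ∈ Ω, f x = 0) {x : Ed d} (hx : x ∈ Ω) (i : Fin d) : pd i f x = 0 := by
  have : f =ᶠ[𝓝 x] fun _ => 0 := by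
    filter_upwards [ho.mem_nhds hx] with y hy using hf y hy
  rw [pd, this.fderiv_eq]
  simp

/-- uniqueness of solutions. -/
theorem uniqueness_of_solutions {d : ℕ} {Ω : Set (Ed d)} {n : Ed d → Ed d}
    {μ lam ν : ℝ} {u₁ u₂ : ℝ → Ed d → Ed d} {θ₁ θ₂ : ℝ → Ed d → ℝ}
    (hdom : GoodDomain d Ω n) (hμ : 0 < μ) (hlam : 0 < 2 * μ + (d : ℝ) * lam)
    (hsol₁ : IsSolution Ω n μ lam ν u₁ θ₁)
    (hsol₂ : IsSolution Ω n μ lam ν u₂ θ₂)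
    (h0u : ∀ x ∈ closure Ω, u₁ 0 x = u₂ 0 x)
    (h0v : ∀ x ∈ closure Ω, tder u₁ 0 x = tder u₂ 0 x)
    (h0θ : ∀ x ∈ closure Ω, θ₁ 0 x = θ₂ 0 x)
    (hbθ₁ : ∃ M : ℝ, ∀ s : ℝ, 0 < s → ∀ x ∈ Ω, |θ₁ s x| ≤ M)
    (hbθ₂ : ∃ M : ℝ, ∀ s : ℝ, 0 < s → ∀ x ∈ Ω, |θ₂ s x| ≤ M)
    (hdiv : ∃ K : ℝ, ∀ s : ℝ, 0 < s →
      Real.sqrt (∫ x in Ω, (divg (tder u₂ s) x) ^ 2) ≤ K)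
    (hhess : ∀ T : ℝ, 0 < T →
      MeasureTheory.IntegrableOn (fun s => ∫ x in Ω, hessNormSq (θ₁ s) x)
        (Set.Ioc 0 T)) :
    ∀ t : ℝ, 0 ≤ t → ∀ x ∈ Ω, u₁ t x = u₂ t x ∧ θ₁ t x = θ₂ t x := by
  have hd : (2 : ℝ) ≤ d := by
    rcases hdom.dims with h | h <;> rw [h] <;> norm_num
  have ha : 0 ≤ 2 * μ + lam := by
    by_contra! h
    nlinarith
  have hw := hsol₁.contDiff_diffDisp hsol₂
  have hφ := hsol₁.contDiff_diffTemp hsol₂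
  have hEn : ContDiff ℝ (⊤ : ℕ∞) (IsSolution.diffEnergy u₁ u₂ θ₁ θ₂ μ lam) :=
    contDiff_energyDensity hw hφ _ _ _
  have hge := energyDensity_ge (τ := timeDir d) (e := spaceDir) ha hμ.le
    (IsSolution.diffDisp u₁ u₂) (IsSolution.diffTemp θ₁ θ₂)
  have hEn0 (p : ℝ × Ed d) : 0 ≤ IsSolution.diffEnergy u₁ u₂ θ₁ θ₂ μ lam p :=
    le_trans (by positivity) (hge p)
  have hinit : ∀ x ∈ Ω, IsSolution.diffEnergy u₁ u₂ θ₁ θ₂ μ lam (0, x) = 0 := by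
    intro x hx
    have hp (i j : Fin d) : dirDeriv (spaceDir i) (IsSolution.diffDisp u₁ u₂ j) (0, x) = 0 := by
      rw [← pd_slice (hw j)]
      exact pd_eq_zero_of_eqOn hdom.isOpen
        (fun y hy => by simp [IsSolution.diffDisp, h0u y (subset_closure hy)]) hx i
    have hv (j : Fin d) : dirDeriv (timeDir d) (IsSolution.diffDisp u₁ u₂ j) (0, x) = 0 := by
      unfold IsSolution.diffDisp
      rw [dirDeriv_sub (contDiff_coord hsol₁.smooth_u j) (contDiff_coord hsol₂.smooth_u j)]
      simp only [← tder_apply hsol₁.smooth_u, ← tder_apply hsol₂.smooth_u]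
      rw [h0v x (subset_closure hx), sub_self]
    have hT : IsSolution.diffTemp θ₁ θ₂ (0, x) = 0 := by
      simp [IsSolution.diffTemp, h0θ x (subset_closure hx)]
    simp [IsSolution.diffEnergy, energyDensity, dirDiv, dirCurl, hp, hv, hT]
  have hzero : ∀ t : ℝ, 0 ≤ t → ∀ x ∈ Ω,
      IsSolution.diffEnergy u₁ u₂ θ₁ θ₂ μ lam (t, x) = 0 := by
    intro t ht x hx
    obtain ⟨C, hC⟩ :=
      IsSolution.exists_setIntegral_dirDeriv_diffEnergy_le hdom hμ.le ha hsol₁ hsol₂ t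
    have hint := eq_zero_of_deriv_le_mul
      (fun s => hasDerivAt_setIntegral hEn hdom.isOpen hdom.bounded s)
      (by rw [setIntegral_congr_fun hdom.isOpen.measurableSet hinit]; simp)
      (fun s => integral_nonneg fun x => hEn0 (s, x)) hC (right_mem_Icc.2 ht)
    rw [setIntegral_eq_zero_iff_of_nonneg_ae (.of_forall fun x => hEn0 (t, x))
      (integrableOn_slice hEn.continuous hdom.bounded t)] at hint
    exact Measure.eqOn_open_of_ae_eq hint hdom.isOpen
      (hEn.continuous.comp (Continuous.prodMk_right t)).continuousOn continuousOn_const hx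
  have hparts : ∀ t : ℝ, 0 ≤ t → ∀ x ∈ Ω, IsSolution.diffTemp θ₁ θ₂ (t, x) = 0 ∧
      ∀ j, dirDeriv (timeDir d) (IsSolution.diffDisp u₁ u₂ j) (t, x) = 0 := by
    intro t ht x hx
    have h1 := (hge (t, x)).trans_eq (hzero t ht x hx)
    have h2 : 0 ≤ ∑ j, dirDeriv (timeDir d) (IsSolution.diffDisp u₁ u₂ j) (t, x) ^ 2 :=
      Finset.sum_nonneg fun j _ => sq_nonneg _
    have h3 := sq_nonneg (IsSolution.diffTemp θ₁ θ₂ (t, x))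
    refine ⟨pow_eq_zero_iff two_ne_zero |>.1 (by linarith), fun j => ?_⟩
    have h4 : ∑ j, dirDeriv (timeDir d) (IsSolution.diffDisp u₁ u₂ j) (t, x) ^ 2 = 0 := by
      linarith
    exact pow_eq_zero_iff two_ne_zero |>.1
      ((Finset.sum_eq_zero_iff_of_nonneg fun j _ => sq_nonneg _).1 h4 j (Finset.mem_univ j))
  intro t ht x hx
  refine ⟨?_, sub_eq_zero.1 (hparts t ht x hx).1⟩
  ext j
  have hconst := constant_of_has_deriv_right_zero
    (f := fun s => IsSolution.diffDisp u₁ u₂ j (s, x)) (a := 0) (b := t)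
    (fun s _ => (hasDerivAt_time (hw j) s x).continuousAt.continuousWithinAt)
    (fun s hs => by
      have := (hasDerivAt_time (hw j) s x).hasDerivWithinAt (s := Ici s)
      rwa [(hparts s hs.1 x hx).2 j] at this)
    t (right_mem_Icc.2 ht)
  have h0 : IsSolution.diffDisp u₁ u₂ j (0, x) = 0 := by
    simp [IsSolution.diffDisp, h0u x (subset_closure hx)]
  exact sub_eq_zero.1 (hconst.trans h0)
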